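/- Let x and y be adjacent vertices of a finite simple graph G that has a bipartition, and suppose N(N(x)) ⊆ N(y), where N(N(x)) is the second neighbourhood of x. Then y is rare. -/

import Mathlib

/-- A set of vertices is stable (independent): no two of its vertices are adjacent. -/
def IsStable {V : Type*} (G : SimpleGraph V) (S : Set V) : Prop :=
  ∀ ⦃u⦄, u ∈ S → ∀ ⦃v⦄, v ∈ S → ¬G.Adj u v

/-- A maximal stable set: stable, and every vertex outside has a neighbour inside. -/
def IsMaxStable {V : Type*} (G : SimpleGraph V) (S : Set V) : Prop :=
  IsStable G S ∧ ∀ v ∉ S, ∃ u ∈ S, G.Adj v u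

/-- The set of all maximal stable sets of `G`. -/
def MSS {V : Type*} (G : SimpleGraph V) : Set (Set V) := {S | IsMaxStable G S}

/-- The number of maximal stable sets of `G` containing all vertices of `X`. -/
noncomputable def mssOn {V : Type*} (G : SimpleGraph V) (X : Set V) : ℕ :=
  {S | S ∈ MSS G ∧ X ⊆ S}.ncard

/-- A vertex is rare if it lies in at most half of the maximal stable sets. -/
def Rare {V : Type*} (G : SimpleGraph V) (v : V) : Prop :=
  2 * mssOn G {v} ≤ (MSS G).ncard

/-- The neighbourhood of a set of vertices: all vertices with a neighbour in `A`. -/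
def NSet {V : Type*} (G : SimpleGraph V) (A : Set V) : Set V := {v | ∃ u ∈ A, G.Adj v u}

/-- A bipartition of `G`: a partition of the vertex set into two stable sets. -/
def IsBipartition {V : Type*} (G : SimpleGraph V) (U W : Set V) : Prop :=
  U ∪ W = Set.univ ∧ Disjoint U W ∧ IsStable G U ∧ IsStable G W

theorem IsBipartition.symm {V : Type*} {G : SimpleGraph V} {U W : Set V}
    (hb : IsBipartition G U W) : IsBipartition G W U :=
  ⟨Set.union_comm U W ▸ hb.1, hb.2.1.symm, hb.2.2.2, hb.2.2.1⟩

theorem IsBipartition.mem_or {V : Type*} {G : SimpleGraph V} {U W : Set V}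
    (hb : IsBipartition G U W) (v : V) : v ∈ U ∨ v ∈ W := by
  have hv : v ∈ U ∪ W := hb.1 ▸ Set.mem_univ v
  exact hv

/-- A maximal stable set of a bipartite graph is determined by its trace on one side. -/
theorem IsMaxStable.subset_of_trace_subset {V : Type*} {G : SimpleGraph V} {U W S T : Set V}
    (hb : IsBipartition G U W) (hS : IsMaxStable G S) (hT : IsMaxStable G T)
    (hST : ∀ w ∈ W, (w ∈ S ↔ w ∈ T)) : S ⊆ T := by
  intro v hv
  rcases hb.mem_or v with hvU | hvW
  · by_contra hvT
    obtain ⟨u, huT, hadj⟩ := hT.2 v hvT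
    rcases hb.mem_or u with huU | huW
    · exact hb.2.2.1 hvU huU hadj
    · exact hS.1 hv ((hST u huW).2 huT) hadj
  · exact (hST v hvW).1 hv

/-- Remove the neighbours of `x` from the trace of `S` on `W`, and complete by all vertices
of `U` having no neighbour in what remains. -/
def exchange {V : Type*} (G : SimpleGraph V) (U W : Set V) (x : V) (S : Set V) : Set V :=
  {v | (v ∈ W ∧ v ∈ S ∧ ¬G.Adj x v) ∨
    (v ∈ U ∧ ∀ w ∈ W, w ∈ S → ¬G.Adj x w → ¬G.Adj v w)}

theorem mem_exchange_self {V : Type*} {G : SimpleGraph V} {U W S : Set V} {x : V}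
    (hx : x ∈ U) : x ∈ exchange G U W x S :=
  Or.inr ⟨hx, fun _ _ _ hw => hw⟩

theorem mem_exchange_iff {V : Type*} {G : SimpleGraph V} {U W S : Set V} {x w : V}
    (hb : IsBipartition G U W) (hw : w ∈ W) :
    w ∈ exchange G U W x S ↔ w ∈ S ∧ ¬G.Adj x w := by
  have hwU : w ∉ U := fun hwU => Set.disjoint_left.1 hb.2.1 hwU hw
  simp [exchange, hw, hwU]

theorem IsMaxStable.exchange {V : Type*} {G : SimpleGraph V} {U W S : Set V} {x : V}
    (hb : IsBipartition G U W) (hS : IsMaxStable G S) (hx : x ∈ U) :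
    IsMaxStable G (exchange G U W x S) := by
  constructor
  · rintro u (⟨huW, huS, hux⟩ | ⟨huU, hu⟩) v (⟨hvW, hvS, hvx⟩ | ⟨hvU, hv⟩) hadj
    · exact hS.1 huS hvS hadj
    · exact hv u huW huS hux hadj.symm
    · exact hu v hvW hvS hvx hadj
    · exact hb.2.2.1 huU hvU hadj
  · intro v hv
    rcases hb.mem_or v with hvU | hvW
    · by_contra! hne
      exact hv (Or.inr ⟨hvU, fun w hwW hwS hwx => hne w (Or.inl ⟨hwW, hwS, hwx⟩)⟩)
    · by_cases hvx : G.Adj x v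
      · exact ⟨x, mem_exchange_self hx, hvx.symm⟩
      · obtain ⟨u, huS, hadj⟩ := hS.2 v fun hvS => hv (Or.inl ⟨hvW, hvS, hvx⟩)
        have huU : u ∈ U := (hb.mem_or u).resolve_right fun huW => hb.2.2.2 hvW huW hadj
        exact ⟨u, Or.inr ⟨huU, fun w _ hwS _ => hS.1 huS hwS⟩, hadj⟩

theorem IsMaxStable.mem_of_adj_of_NSet_subset {V : Type*} {G : SimpleGraph V} {S : Set V}
    {x y z : V} (h : NSet G (G.neighborSet x) ⊆ G.neighborSet y) (hS : IsMaxStable G S)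
    (hy : y ∈ S) (hz : G.Adj x z) : z ∈ S := by
  by_contra hzS
  obtain ⟨u, huS, hadj⟩ := hS.2 z hzS
  exact hS.1 hy huS (h ⟨z, hz, hadj.symm⟩)

/-- If `x` and `y` are adjacent in a graph admitting a bipartition and the second
neighbourhood of `x` is contained in `N(y)`, then `y` is rare. -/
theorem rare_of_second_neighborhood {V : Type} [Fintype V] (G : SimpleGraph V)
    (hb : ∃ U W, IsBipartition G U W) (x y : V) (hxy : G.Adj x y)
    (h : NSet G (G.neighborSet x) ⊆ G.neighborSet y) :
    Rare G y := by
  obtain ⟨U, W, hb, hx⟩ : ∃ U W, IsBipartition G U W ∧ x ∈ U := by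
    obtain ⟨U, W, hb⟩ := hb
    rcases hb.mem_or x with hx | hx
    · exact ⟨U, W, hb, hx⟩
    · exact ⟨W, U, hb.symm, hx⟩
  set A : Set (Set V) := {S | S ∈ MSS G ∧ {y} ⊆ S}
  have hAsub : A ⊆ MSS G := fun S hS => hS.1
  have hle : A.ncard ≤ (MSS G \ A).ncard := by
    refine Set.ncard_le_ncard_of_injOn (exchange G U W x) ?_ ?_ (Set.toFinite _)
    · rintro S ⟨hS, -⟩
      have hT := IsMaxStable.exchange hb hS hx
      exact ⟨hT, fun hy => hT.1 (mem_exchange_self hx) (hy.2 rfl) hxy⟩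
    · rintro S ⟨hS, hyS⟩ T ⟨hT, hyT⟩ hST
      have htrace : ∀ w ∈ W, (w ∈ S ↔ w ∈ T) := by
        intro w hw
        by_cases hxw : G.Adj x w
        · exact iff_of_true (hS.mem_of_adj_of_NSet_subset h (hyS rfl) hxw)
            (hT.mem_of_adj_of_NSet_subset h (hyT rfl) hxw)
        · have hiff : w ∈ exchange G U W x S ↔ w ∈ exchange G U W x T := by rw [hST]
          simpa [mem_exchange_iff hb hw, hxw] using hiff
      exact (hS.subset_of_trace_subset hb hT htrace).antisymm
        (hT.subset_of_trace_subset hb hS fun w hw => (htrace w hw).symm)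
  have hcard := Set.ncard_sdiff_add_ncard_of_subset hAsub (Set.toFinite _)
  change 2 * A.ncard ≤ (MSS G).ncard
  omega
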